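/- Let T = (S, δ) be an LTS, let D : 2^S → 2^S be the monotone map D(A) = {s | ∃t, (s,a,t) ∈ δ ∧ t ∈ A}, and let B = {s | ∃t, (s,b,t) ∈ δ}. Define F as the least fixed point of the monotone functional Φ on the lattice of monotone maps (2^S → 2^S) → (2^S → 2^S) given by Φ(F)(G)(X) = G(X) ∪ F(G∘G)(X). Then for every state s, s ∈ F(D)(B) if and only if there exists n ≥ 0 and a path labeled a^{2^n} b starting at s. -/

import Mathlib

/-- The two-letter alphabet {a, b}. -/
inductive AB : Type
  | a | b
  deriving DecidableEq

section
variable {S : Type} (δ : S → AB → S → Prop)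

/-- The diamond-a map D(A) = {s | ∃t, (s,a,t) ∈ δ ∧ t ∈ A}, as a monotone map. -/
def Dmap : Set S →o Set S :=
  ⟨fun A => {s | ∃ t, δ s AB.a t ∧ t ∈ A},
   fun A B hAB s hs => by obtain ⟨t, ht, htA⟩ := hs; exact ⟨t, ht, hAB htA⟩⟩

/-- B = {s | ∃t, (s,b,t) ∈ δ} = ⟦⟨b⟩⊤⟧. -/
def Bset : Set S := {s | ∃ t, δ s AB.b t}

/-- The monotone second-order functional Φ(F)(G)(X) = G(X) ∪ F(G∘G)(X) on the
complete lattice of monotone maps (2^S → 2^S) → (2^S → 2^S). -/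
def Phi : ((Set S →o Set S) →o (Set S →o Set S)) →o
    ((Set S →o Set S) →o (Set S →o Set S)) where
  toFun F :=
    { toFun := fun G =>
        { toFun := fun X => G X ∪ F (G.comp G) X
          monotone' := fun X Y hXY =>
            Set.union_subset_union (G.mono hXY) ((F (G.comp G)).mono hXY) }
      monotone' := by
        intro G G' h X
        have hcomp : G.comp G ≤ G'.comp G' := fun Z => (h (G Z)).trans (G'.mono (h Z))
        exact Set.union_subset_union (h X) ((F.mono hcomp) X) }
  monotone' := by
    intro F F' h G X
    exact Set.union_subset_union (le_refl _) (h (G.comp G) X)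

/-- There is a path labeled by the word `w` starting at `s`. -/
def hasPath : S → List AB → Prop
  | _, [] => True
  | s, c :: w => ∃ t, δ s c t ∧ hasPath t w

/-- The explicit solution: the union of the iterates `G^(2^n)`. -/
def HflIter (S : Type) : (Set S →o Set S) →o (Set S →o Set S) where
  toFun G :=
    { toFun := fun X => ⋃ n : ℕ, (⇑G)^[2 ^ n] X
      monotone' := fun _ _ hXY => Set.iUnion_mono fun n => (G.mono.iterate (2 ^ n)) hXY }
  monotone' := by
    intro G G' h X
    exact Set.iUnion_mono fun n => Monotone.iterate_le_of_le G.mono h (2 ^ n) X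

theorem hfl_iter_comp (G : Set S →o Set S) (n : ℕ) (X : Set S) :
    (⇑(G.comp G))^[2 ^ n] X = (⇑G)^[2 ^ (n + 1)] X := by
  have h : (⇑(G.comp G)) = (⇑G)^[2] := rfl
  rw [h, ← Function.iterate_mul, pow_succ, mul_comm]

theorem hfl_lfp_le : OrderHom.lfp (Phi (S := S)) ≤ HflIter S := by
  apply OrderHom.lfp_le
  intro G X
  refine Set.union_subset ?_ ?_
  · exact Set.subset_iUnion (fun n : ℕ => (⇑G)^[2 ^ n] X) 0
  · refine Set.iUnion_subset fun n => ?_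
    rw [hfl_iter_comp]
    exact Set.subset_iUnion (fun n : ℕ => (⇑G)^[2 ^ n] X) (n + 1)

theorem hfl_unfold (G : Set S →o Set S) (X : Set S) :
    (OrderHom.lfp (Phi (S := S))) G X = G X ∪ (OrderHom.lfp (Phi (S := S))) (G.comp G) X := by
  conv_lhs => rw [← OrderHom.map_lfp]
  rfl

theorem hfl_le_lfp (n : ℕ) : ∀ (G : Set S →o Set S) (X : Set S),
    (⇑G)^[2 ^ n] X ⊆ (OrderHom.lfp (Phi (S := S))) G X := by
  induction n with
  | zero => intro G X; rw [hfl_unfold]; exact Set.subset_union_left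
  | succ n ih =>
    intro G X
    rw [hfl_unfold, ← hfl_iter_comp]
    exact (ih _ _).trans Set.subset_union_right

theorem hfl_path (k : ℕ) : ∀ s : S,
    s ∈ (⇑(Dmap δ))^[k] (Bset δ) ↔ hasPath δ s (List.replicate k AB.a ++ [AB.b]) := by
  induction k with
  | zero => intro s; simp [Bset, hasPath]
  | succ k ih =>
    intro s
    rw [Function.iterate_succ_apply', List.replicate_succ, List.cons_append]
    exact exists_congr fun t => and_congr_right fun _ => ih t

/-- letting F be the least fixed point of Φ, a state s belongs to
F(D)(B) iff there is some n ≥ 0 and a path labeled a^(2^n) b starting at s. -/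
theorem hfl_double_exponential_semantics (s : S) :
    s ∈ (OrderHom.lfp (Phi (S := S))) (Dmap δ) (Bset δ) ↔
      ∃ n : ℕ, hasPath δ s (List.replicate (2 ^ n) AB.a ++ [AB.b]) := by
  constructor
  · intro h
    obtain ⟨n, hn⟩ := Set.mem_iUnion.1 (hfl_lfp_le (Dmap δ) (Bset δ) h)
    exact ⟨n, (hfl_path δ _ s).1 hn⟩
  · rintro ⟨n, hn⟩
    exact hfl_le_lfp n _ _ ((hfl_path δ _ s).2 hn)

end
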